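/- (Privacy of DP-Thresholding.) Let 0 < ε ≤ 1, 0 < δ ≤ 1, and let σ₁ = 2·√(ln(1.25/δ))/(n·ε). For a dataset D = (x₁, …, xₙ) of vectors in ℝᵖ with ‖xᵢ‖₂ ≤ 1, let M(D) be the law of Σ*(D) + N, where Σ*(D) = (1/n)·Σₖ xₖxₖᵀ and N is a symmetric Gaussian noise matrix with parameter σ₁. Then for any two datasets D, D' of unit-norm vectors differing in exactly one entry, for every measurable set S of symmetric p×p matrices, M(D)(S) ≤ e^ε · M(D')(S) + δ; and the same inequality holds for the laws of f(Σ*(D) + N) and f(Σ*(D') + N) for any measurable map f on symmetric matrices (in particular for the output Σ⁺ of the DP-Thresholding algorithm). -/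

import Mathlib

open MeasureTheory ProbabilityTheory Real NNReal

instance {p : ℕ} : MeasurableSpace (Matrix (Fin p) (Fin p) ℝ) :=
  inferInstanceAs (MeasurableSpace (Fin p → Fin p → ℝ))

/-- The law of a random symmetric `p×p` matrix whose upper-triangular entries (including the
diagonal) are i.i.d. `N(0, v)` and whose lower triangle mirrors the upper triangle. -/
noncomputable def symmGaussian (p : ℕ) (v : ℝ≥0) :
    Measure (Matrix (Fin p) (Fin p) ℝ) :=
  (Measure.pi fun _ : Fin p => Measure.pi fun _ : Fin p => gaussianReal 0 v).map
    (fun g => Matrix.of fun i j => if i ≤ j then g i j else g j i)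

/-- The empirical covariance matrix `Σ* = (1/n)·∑ₖ xₖ xₖᵀ` of `n` samples. -/
noncomputable def empCov (p n : ℕ) (x : Fin n → Fin p → ℝ) :
    Matrix (Fin p) (Fin p) ℝ :=
  Matrix.of fun i j => (1 / n : ℝ) * ∑ k, x k i * x k j

/-- Cameron–Martin data: shifting `μ` by `b` has density `exp (ℓ - q/2)`, `ℓ` is centred Gaussian
with variance `q` under `μ`, and `ℓ (b + g) = q + ℓ g`. -/
structure CamMart {E : Type*} [MeasurableSpace E] [Add E] (μ : Measure E) (b : E) (ℓ : E → ℝ)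
    (q : ℝ≥0) : Prop where
  measShift : Measurable (fun g : E => b + g)
  meas : Measurable ℓ
  dens : μ.map (fun g => b + g) = μ.withDensity (fun g => ENNReal.ofReal (Real.exp (ℓ g - q / 2)))
  law : μ.map ℓ = gaussianReal 0 q
  shift : ∀ g, ℓ (b + g) = q + ℓ g

lemma camMart_gaussian (v : ℝ≥0) (hv : v ≠ 0) (b : ℝ) :
    CamMart (gaussianReal 0 v) b (fun x => b / v * x) (.mk (b ^ 2) (sq_nonneg _) / v) where
  measShift := by fun_prop
  meas := by fun_prop
  dens := by
    have hv' : (v : ℝ) ≠ 0 := by exact_mod_cast hv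
    rw [gaussianReal_map_const_add, gaussianReal_of_var_ne_zero _ hv,
      gaussianReal_of_var_ne_zero _ hv, ← withDensity_mul _ (by fun_prop) (by fun_prop)]
    congr 1
    ext x
    simp only [gaussianPDF, Pi.mul_apply]
    rw [← ENNReal.ofReal_mul (gaussianPDFReal_nonneg _ _ _)]
    congr 1
    simp only [gaussianPDFReal]
    rw [mul_assoc _ (Real.exp _) (Real.exp _), ← Real.exp_add]
    congr 2
    push_cast
    field_simp
    ring
  law := by
    have hv' : (v : ℝ) ≠ 0 := by exact_mod_cast hv
    rw [gaussianReal_map_const_mul]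
    congr 1
    · simp
    · ext
      push_cast
      field_simp
  shift := by
    intro g
    push_cast
    ring

lemma pi_withDensity' {ι : Type*} [Fintype ι] {E : ι → Type*} [∀ i, MeasurableSpace (E i)]
    (μ : ∀ i, Measure (E i)) [∀ i, IsProbabilityMeasure (μ i)] (f : ∀ i, E i → ENNReal)
    (hf : ∀ i, Measurable (f i)) [∀ i, SigmaFinite ((μ i).withDensity (f i))] :
    Measure.pi (fun i => (μ i).withDensity (f i))
      = (Measure.pi μ).withDensity (fun g => ∏ i, f i (g i)) := by
  refine Measure.pi_eq fun s hs => ?_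
  rw [withDensity_apply _ (MeasurableSet.univ_pi hs), ← lintegral_indicator (MeasurableSet.univ_pi hs)]
  have h1 : ∀ g : ∀ i, E i, (Set.univ.pi s).indicator (fun g => ∏ i, f i (g i)) g
      = ∏ i, (s i).indicator (f i) (g i) := by
    intro g
    by_cases hg : g ∈ Set.univ.pi s
    · rw [Set.indicator_of_mem hg]
      refine Finset.prod_congr rfl fun i _ => ?_
      rw [Set.indicator_of_mem (hg i (Set.mem_univ i))]
    · rw [Set.indicator_of_notMem hg]
      simp only [Set.mem_pi, Set.mem_univ, true_imp_iff, not_forall] at hg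
      obtain ⟨i, hi⟩ := hg
      exact (Finset.prod_eq_zero (Finset.mem_univ i) (Set.indicator_of_notMem hi _)).symm
  simp_rw [h1]
  have hm : ∀ i, Measurable ((s i).indicator (f i)) := fun i => (hf i).indicator (hs i)
  rw [lintegral_prod_eq_prod_lintegral_of_indepFun Finset.univ
    (fun i (g : ∀ i, E i) => (s i).indicator (f i) (g i))
    (iIndepFun_pi (fun i => (hm i).aemeasurable))
    (fun i => (hm i).comp (measurable_pi_apply i))]
  refine Finset.prod_congr rfl fun i _ => ?_
  rw [withDensity_apply _ (hs i), ← lintegral_indicator (hs i),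
    ← (measurePreserving_eval μ i).lintegral_comp (hm i)]

lemma camMart_pi {ι : Type*} [Fintype ι] {E : ι → Type*} [∀ i, MeasurableSpace (E i)]
    [∀ i, Add (E i)]
    (μ : ∀ i, Measure (E i)) [∀ i, IsProbabilityMeasure (μ i)] (b : ∀ i, E i)
    (ℓ : ∀ i, E i → ℝ) (q : ι → ℝ≥0) (h : ∀ i, CamMart (μ i) (b i) (ℓ i) (q i)) :
    CamMart (Measure.pi μ) b (fun g => ∑ i, ℓ i (g i)) (∑ i, q i) where
  measShift := by
    refine measurable_pi_lambda _ fun i => ?_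
    exact (h i).measShift.comp (measurable_pi_apply i)
  meas := Finset.measurable_sum _ fun i _ => (h i).meas.comp (measurable_pi_apply i)
  dens := by
    have hp : ∀ i, IsProbabilityMeasure ((μ i).map (fun g => b i + g)) := fun i =>
      Measure.isProbabilityMeasure_map (h i).measShift.aemeasurable
    have hp' : ∀ i, IsProbabilityMeasure
        ((μ i).withDensity (fun g => ENNReal.ofReal (Real.exp (ℓ i g - q i / 2)))) := fun i => by
      rw [← (h i).dens]; exact hp i
    have e := Measure.pi_map_pi (μ := μ) (f := fun i g => b i + g)
      (fun i => (h i).measShift.aemeasurable)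
    refine Eq.trans e ?_
    simp_rw [(h _).dens]
    rw [pi_withDensity' μ _ (fun i => by have := (h i).meas; fun_prop)]
    congr 1
    ext g
    rw [← ENNReal.ofReal_prod_of_nonneg (fun _ _ => (Real.exp_pos _).le), ← Real.exp_sum]
    congr 2
    rw [Finset.sum_sub_distrib]
    push_cast
    rw [Finset.sum_div]
  law := by
    have hm : ∀ i, Measurable (fun g : ∀ i, E i => ℓ i (g i)) :=
      fun i => (h i).meas.comp (measurable_pi_apply i)
    have hs : Measurable (fun g : ∀ i, E i => ∑ i, ℓ i (g i)) :=
      Finset.measurable_sum _ fun i _ => hm i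
    have : IsProbabilityMeasure ((Measure.pi μ).map (fun g : ∀ i, E i => ∑ i, ℓ i (g i))) :=
      Measure.isProbabilityMeasure_map hs.aemeasurable
    refine Measure.ext_of_charFun ?_
    have hi : iIndepFun (fun i (g : ∀ i, E i) => ℓ i (g i)) (Measure.pi μ) :=
      iIndepFun_pi (fun i => (h i).meas.aemeasurable)
    have e := hi.charFun_map_sum_eq_prod (fun i => (hm i).aemeasurable)
    have e2 : (∑ i, fun g : ∀ i, E i => ℓ i (g i)) = fun g => ∑ i, ℓ i (g i) := by
      ext g; simp
    rw [e2] at e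
    rw [e]
    ext t
    rw [Finset.prod_apply]
    have e3 : ∀ i, (Measure.pi μ).map (fun g : ∀ i, E i => ℓ i (g i)) = gaussianReal 0 (q i) := by
      intro i
      rw [← (h i).law, ← (measurePreserving_eval μ i).map_eq,
        Measure.map_map (h i).meas (measurable_pi_apply i)]
      rfl
    simp_rw [e3, charFun_gaussianReal]
    rw [← Complex.exp_sum]
    congr 1
    push_cast
    rw [Finset.sum_sub_distrib, Finset.sum_mul, Finset.sum_div]
    simp
  shift := by
    intro g
    push_cast
    rw [← Finset.sum_add_distrib]
    exact Finset.sum_congr rfl fun i _ => (h i).shift (g i)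

lemma CamMart.dp {E : Type*} [MeasurableSpace E] [Add E] {μ : Measure E} {b : E} {ℓ : E → ℝ}
    {q : ℝ≥0} (h : CamMart μ b ℓ q) (ε : ℝ) (S : Set E) (hS : MeasurableSet S) :
    μ.map (fun g => b + g) S ≤ ENNReal.ofReal (Real.exp ε) * μ S
      + gaussianReal 0 q (Set.Ioi (ε - q / 2)) := by
  set A : Set E := {g | ℓ g - q / 2 ≤ ε}
  have hA : MeasurableSet A := measurableSet_le (h.meas.sub_const _) measurable_const
  have h1 : μ.map (fun g => b + g) S ≤ μ.map (fun g => b + g) (S ∩ A)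
      + μ.map (fun g => b + g) Aᶜ := by
    refine (measure_mono ?_).trans (measure_union_le _ _)
    intro x hx
    by_cases hxA : x ∈ A
    · exact Or.inl ⟨hx, hxA⟩
    · exact Or.inr hxA
  refine h1.trans (add_le_add ?_ ?_)
  · rw [h.dens, withDensity_apply _ (hS.inter hA)]
    calc ∫⁻ g in S ∩ A, ENNReal.ofReal (Real.exp (ℓ g - q / 2)) ∂μ
        ≤ ∫⁻ g in S ∩ A, ENNReal.ofReal (Real.exp ε) ∂μ := by
          refine setLIntegral_mono measurable_const fun g hg => ?_
          exact ENNReal.ofReal_le_ofReal (Real.exp_le_exp.2 hg.2)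
      _ = ENNReal.ofReal (Real.exp ε) * μ (S ∩ A) := by simp
      _ ≤ _ := by gcongr; exact Set.inter_subset_left
  · rw [Measure.map_apply h.measShift hA.compl, ← h.law, Measure.map_apply h.meas measurableSet_Ioi]
    refine measure_mono fun g hg => ?_
    simp only [A, Set.mem_preimage, Set.mem_compl_iff, Set.mem_ofPred_eq, h.shift, Set.mem_Ioi,
      not_le] at hg ⊢
    linarith

lemma gauss_half : gaussianReal 0 1 (Set.Ioi 0) ≤ ENNReal.ofReal (1 / 2) := by
  have h1 : gaussianReal 0 1 (Set.Iio 0) = gaussianReal 0 1 (Set.Ioi 0) := by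
    have := gaussianReal_map_neg (μ := 0) (v := 1)
    rw [neg_zero] at this
    conv_lhs => rw [← this]
    rw [Measure.map_apply measurable_neg measurableSet_Iio]
    congr 1
    ext x; simp
  have h2 : gaussianReal 0 1 (Set.Iio 0) + gaussianReal 0 1 (Set.Ioi 0) ≤ 1 := by
    rw [← measure_union (by
      rw [Set.disjoint_left]; intro x hx hx'
      exact lt_asymm (Set.mem_Iio.1 hx) (Set.mem_Ioi.1 hx')) measurableSet_Ioi]
    exact prob_le_one
  rw [h1, ← two_mul] at h2
  rw [ENNReal.ofReal_div_of_pos two_pos, ENNReal.le_div_iff_mul_le (by simp) (by simp)]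
  simpa [mul_comm] using h2

lemma gauss_tail_pos (t : ℝ) (ht : 0 ≤ t) :
    gaussianReal 0 1 (Set.Ioi t) ≤ ENNReal.ofReal (Real.exp (-t ^ 2 / 2) * (1 / 2)) := by
  have h := camMart_gaussian 1 one_ne_zero (-t)
  have h1 : gaussianReal 0 1 (Set.Ioi t)
      = (gaussianReal 0 1).map (fun g => -t + g) (Set.Ioi 0) := by
    rw [Measure.map_apply (by fun_prop) measurableSet_Ioi]
    congr 1
    ext x; simp
  rw [h1, h.dens, withDensity_apply _ measurableSet_Ioi,
    ENNReal.ofReal_mul (Real.exp_pos _).le]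
  refine le_trans ?_ (mul_le_mul_right gauss_half _)
  rw [← setLIntegral_const]
  refine setLIntegral_mono measurable_const fun x hx => ?_
  refine ENNReal.ofReal_le_ofReal (Real.exp_le_exp.2 ?_)
  have := mul_nonneg ht (Set.mem_Ioi.1 hx).le
  simp
  linarith

lemma gauss_tail_neg (t : ℝ) (ht : t ≤ 0) :
    gaussianReal 0 1 (Set.Ioi t) ≤ ENNReal.ofReal (1 / 2 - t) := by
  have h1 : gaussianReal 0 1 (Set.Ioi t)
      ≤ gaussianReal 0 1 (Set.Ioi 0) + gaussianReal 0 1 (Set.Icc t 0) := by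
    refine (measure_mono ?_).trans (measure_union_le _ _)
    intro x hx
    by_cases h : 0 < x
    · exact Or.inl h
    · exact Or.inr ⟨le_of_lt hx, not_lt.1 h⟩
  refine h1.trans ?_
  rw [sub_eq_add_neg, ENNReal.ofReal_add (by norm_num) (by linarith)]
  refine add_le_add gauss_half ?_
  rw [gaussianReal_apply _ one_ne_zero]
  calc ∫⁻ x in Set.Icc t 0, gaussianPDF 0 1 x
      ≤ ∫⁻ x in Set.Icc t 0, 1 := by
        refine setLIntegral_mono measurable_const fun x _ => ?_
        simp only [gaussianPDF, ENNReal.ofReal_le_one, gaussianPDFReal]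
        refine mul_le_one₀ ?_ (Real.exp_pos _).le ?_
        · refine inv_le_one_of_one_le₀ ?_
          rw [Real.one_le_sqrt]
          have := Real.pi_gt_three
          norm_num
          linarith
        · rw [Real.exp_le_one_iff]
          exact div_nonpos_of_nonpos_of_nonneg (neg_nonpos.2 (sq_nonneg _)) (by positivity)
    _ = _ := by simp

/-- Tail bound. -/
lemma gauss_tail (c δ : ℝ) (hc : 0 < c) (hδ : 0 < δ) (hδ1 : δ ≤ 1)
    (hcδ : c ^ 2 = 2 * Real.log (1.25 / δ)) :
    gaussianReal 0 1 (Set.Ioi (c - 1 / (2 * c))) ≤ ENNReal.ofReal δ := by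
  have hδe : δ = 1.25 * Real.exp (-c ^ 2 / 2) := by
    have : -c ^ 2 / 2 = - Real.log (1.25 / δ) := by rw [neg_div, hcδ]; ring
    rw [this, Real.exp_neg, Real.exp_log (by positivity)]
    field_simp
  have hc2 : 0.4 ≤ c ^ 2 := by
    have : Real.log 1.25 ≤ Real.log (1.25 / δ) := by
      apply Real.log_le_log (by norm_num)
      rw [le_div_iff₀ hδ]; nlinarith
    have := Real.one_sub_inv_le_log_of_pos (show (0:ℝ) < 1.25 by norm_num)
    norm_num at this ⊢
    norm_num at *
    linarith
  rcases le_total 0 (c - 1 / (2 * c)) with ht | ht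
  · refine (gauss_tail_pos _ ht).trans (ENNReal.ofReal_le_ofReal ?_)
    have h1 : -(c - 1 / (2 * c)) ^ 2 / 2 ≤ -c ^ 2 / 2 + 1 / 2 := by
      have : (c - 1 / (2 * c)) ^ 2 = c ^ 2 - 1 + (1 / (2 * c)) ^ 2 := by field_simp; ring
      have := sq_nonneg (1 / (2 * c))
      linarith
    have h2 : Real.exp (1 / 2) ≤ 2 := by
      have h3 : Real.exp (1 / 2) ^ 2 = Real.exp 1 := by
        rw [← Real.exp_nat_mul]; norm_num
      have := Real.exp_one_lt_d9
      nlinarith [Real.exp_pos (1 / 2)]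
    have h4 := Real.exp_le_exp.2 h1
    rw [Real.exp_add] at h4
    have := Real.exp_pos (-c ^ 2 / 2)
    nlinarith
  · refine (gauss_tail_neg _ ht).trans (ENNReal.ofReal_le_ofReal ?_)
    have h1 : c ≤ 1 / (2 * c) := by linarith
    rw [le_div_iff₀ (by positivity)] at h1
    have h2 : 0.6 ≤ c := by nlinarith
    have h3 : 1 / (2 * c) - c ≤ 0.25 := by
      rw [sub_le_iff_le_add, div_le_iff₀ (by positivity)]
      nlinarith
    have h4 := Real.add_one_le_exp (-c ^ 2 / 2)
    norm_num at *
    nlinarith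

lemma gauss_tail_q (c δ ε : ℝ) (hc : 0 < c) (hδ : 0 < δ) (hδ1 : δ ≤ 1) (hε : 0 < ε) (hε1 : ε ≤ 1)
    (hcδ : c ^ 2 = 2 * Real.log (1.25 / δ)) (q : ℝ≥0) (hq : q * c ^ 2 ≤ ε ^ 2) :
    gaussianReal 0 q (Set.Ioi (ε - q / 2)) ≤ ENNReal.ofReal δ := by
  rcases eq_or_ne q 0 with rfl | hq0
  · simp [hε.le]
  have hqp : 0 < (q : ℝ) := by positivity
  set r := Real.sqrt q with hr
  have hrp : 0 < r := Real.sqrt_pos.2 hqp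
  have hr2 : r ^ 2 = q := Real.sq_sqrt hqp.le
  have hrc : r * c ≤ ε := by
    refine (sq_le_sq₀ (by positivity) hε.le).1 ?_
    rw [mul_pow, hr2]; exact hq
  have e : gaussianReal 0 q = (gaussianReal 0 1).map (r * ·) := by
    rw [gaussianReal_map_const_mul]
    congr 1
    · simp
    · ext
      simp [hr2]
  rw [e, Measure.map_apply (by fun_prop) measurableSet_Ioi]
  refine le_trans (measure_mono ?_) (gauss_tail c δ hc hδ hδ1 hcδ)
  intro x hx
  simp only [Set.mem_preimage, Set.mem_Ioi] at hx ⊢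
  rw [← hr2] at hx
  have h1 : r / 2 ≤ 1 / (2 * c) := by
    rw [div_le_div_iff₀ two_pos (by positivity)]
    nlinarith
  have h2 : r * (c - r / 2) < r * x := by nlinarith
  have := lt_of_mul_lt_mul_left h2 hrp.le
  linarith

lemma sens_bound {p : ℕ} (x y : Fin p → ℝ) (hx : ∑ i, x i ^ 2 ≤ 1) (hy : ∑ i, y i ^ 2 ≤ 1) :
    ∑ i, ∑ j, (x i * x j - y i * y j) ^ 2 ≤ 2 := by
  have e : ∑ i, ∑ j, (x i * x j - y i * y j) ^ 2
      = (∑ i, x i ^ 2) * (∑ i, x i ^ 2) + (∑ i, y i ^ 2) * (∑ i, y i ^ 2)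
        - 2 * ((∑ i, x i * y i) * (∑ i, x i * y i)) := by
    rw [Finset.sum_mul_sum, Finset.sum_mul_sum, Finset.sum_mul_sum]
    simp only [Finset.mul_sum, ← Finset.sum_add_distrib,
      ← Finset.sum_sub_distrib]
    refine Finset.sum_congr rfl fun i _ => Finset.sum_congr rfl fun j _ => ?_
    ring
  rw [e]
  have h1 : 0 ≤ ∑ i, x i ^ 2 := Finset.sum_nonneg fun _ _ => sq_nonneg _
  have h2 : 0 ≤ ∑ i, y i ^ 2 := Finset.sum_nonneg fun _ _ => sq_nonneg _
  nlinarith [mul_self_nonneg (∑ i, x i * y i)]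

lemma empCov_sub {p n : ℕ} (D D' : Fin n → Fin p → ℝ) (k₀ : Fin n)
    (hdiff : ∀ k, k ≠ k₀ → D k = D' k) (i j : Fin p) :
    empCov p n D i j - empCov p n D' i j
      = (1 / n : ℝ) * (D k₀ i * D k₀ j - D' k₀ i * D' k₀ j) := by
  simp only [empCov, Matrix.of_apply]
  rw [← mul_sub, ← Finset.sum_sub_distrib]
  congr 1
  refine Finset.sum_eq_single k₀ (fun k _ hk => ?_) (fun h => absurd (Finset.mem_univ _) h)
  rw [hdiff k hk, sub_self]

lemma empCov_symm {p n : ℕ} (D : Fin n → Fin p → ℝ) (i j : Fin p) :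
    empCov p n D i j = empCov p n D j i := by
  simp only [empCov, Matrix.of_apply]
  simp_rw [mul_comm (D _ i)]

/-- Mirror the upper triangle. -/
def mirror (p : ℕ) (g : Fin p → Fin p → ℝ) : Matrix (Fin p) (Fin p) ℝ :=
  Matrix.of fun i j => if i ≤ j then g i j else g j i

/-- The upper triangle of the empirical covariance. -/
noncomputable def upperCov (p n : ℕ) (D : Fin n → Fin p → ℝ) : Fin p → Fin p → ℝ :=
  fun i j => if i ≤ j then empCov p n D i j else 0

lemma measurable_mirror (p : ℕ) : Measurable (mirror p) := by
  refine measurable_pi_lambda (δ := Fin p) (X := fun _ => Fin p → ℝ) _ fun i => measurable_pi_lambda _ fun j => ?_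
  simp only [mirror, Matrix.of_apply]
  split_ifs <;> fun_prop

lemma mirror_upper {p n : ℕ} (D : Fin n → Fin p → ℝ) (g : Fin p → Fin p → ℝ) :
    empCov p n D + mirror p g = mirror p (upperCov p n D + g) := by
  ext i j
  simp only [mirror, Matrix.of_apply, Matrix.add_apply, Pi.add_apply, upperCov]
  split_ifs with h1 h2
  · rfl
  · rw [empCov_symm]
  · exact absurd (le_of_not_ge h1) h2

lemma law_eq {p n : ℕ} (v : ℝ≥0) (D : Fin n → Fin p → ℝ) :
    (symmGaussian p v).map (fun N => empCov p n D + N)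
      = (Measure.pi fun _ : Fin p => Measure.pi fun _ : Fin p => gaussianReal 0 v).map
          (fun g => mirror p (upperCov p n D + g)) := by
  have hm : Measurable (fun N : Matrix (Fin p) (Fin p) ℝ => empCov p n D + N) :=
    measurable_const_add (M := Fin p → Fin p → ℝ) (empCov p n D)
  change (Measure.map (mirror p) _).map _ = _
  rw [Measure.map_map hm (measurable_mirror p)]
  congr 1
  ext1 g
  exact mirror_upper D g

lemma dp_main (p n : ℕ) (hn : 1 ≤ n)
    (ε δ : ℝ) (hε : 0 < ε) (hε1 : ε ≤ 1) (hδ : 0 < δ) (hδ1 : δ ≤ 1)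
    (σ₁ : ℝ) (hσ₁ : σ₁ = 2 * Real.sqrt (Real.log (1.25 / δ)) / (n * ε))
    (D D' : Fin n → Fin p → ℝ)
    (hD : ∀ k, ∑ i, D k i ^ 2 ≤ 1) (hD' : ∀ k, ∑ i, D' k i ^ 2 ≤ 1)
    (k₀ : Fin n) (hdiff : ∀ k, k ≠ k₀ → D k = D' k)
    (S : Set (Matrix (Fin p) (Fin p) ℝ)) (hS : MeasurableSet S) :
      ((symmGaussian p (Real.toNNReal (σ₁ ^ 2))).map (fun N => empCov p n D + N)) S
        ≤ ENNReal.ofReal (Real.exp ε) *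
            ((symmGaussian p (Real.toNNReal (σ₁ ^ 2))).map (fun N => empCov p n D' + N)) S
          + ENNReal.ofReal δ := by
  have hL : 0 < Real.log (1.25 / δ) := by
    apply Real.log_pos
    rw [lt_div_iff₀ hδ]; norm_num; linarith
  have hn' : (0 : ℝ) < n := by exact_mod_cast hn
  set L := Real.log (1.25 / δ) with hLdef
  have hσ2 : σ₁ ^ 2 = 4 * L / (n * ε) ^ 2 := by
    rw [hσ₁, div_pow, mul_pow, Real.sq_sqrt hL.le]; norm_num
  have hσp : 0 < σ₁ ^ 2 := by rw [hσ2]; positivity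
  set v := Real.toNNReal (σ₁ ^ 2) with hv
  have hvc : (v : ℝ) = σ₁ ^ 2 := Real.coe_toNNReal _ hσp.le
  have hv0 : v ≠ 0 := by
    intro h; rw [h] at hvc; simp at hvc; rw [← hvc] at hσp; simp at hσp
  set b : Fin p → Fin p → ℝ := upperCov p n D - upperCov p n D' with hb
  have hCM := camMart_pi (fun _ : Fin p => Measure.pi fun _ : Fin p => gaussianReal 0 v) b _ _
    (fun i => camMart_pi (fun _ : Fin p => gaussianReal 0 v) (b i) _ _
      (fun j => camMart_gaussian v hv0 (b i j)))
  have hq : ((∑ i, ∑ j, (NNReal.mk (b i j ^ 2) (sq_nonneg _) / v) : ℝ≥0) : ℝ) * (Real.sqrt (2 * L)) ^ 2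
      ≤ ε ^ 2 := by
    rw [Real.sq_sqrt (by positivity)]
    push_cast
    simp only [hvc]
    simp_rw [← Finset.sum_div]
    have h1 : ∑ i, ∑ j, b i j ^ 2 ≤ (1 / n : ℝ) ^ 2 * 2 := by
      refine le_trans ?_ (mul_le_mul_of_nonneg_left
        (sens_bound (D k₀) (D' k₀) (hD k₀) (hD' k₀)) (by positivity))
      rw [Finset.mul_sum]
      refine Finset.sum_le_sum fun i _ => ?_
      rw [Finset.mul_sum]
      refine Finset.sum_le_sum fun j _ => ?_
      simp only [hb, Pi.sub_apply, upperCov]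
      split_ifs
      · rw [empCov_sub D D' k₀ hdiff, mul_pow]
      · simp; positivity
    rw [hσ2]
    calc (∑ i, ∑ j, b i j ^ 2) / (4 * L / (n * ε) ^ 2) * (2 * L)
        ≤ ((1 / n : ℝ) ^ 2 * 2) / (4 * L / (n * ε) ^ 2) * (2 * L) := by gcongr
      _ = ε ^ 2 := by field_simp; ring
  have htail := gauss_tail_q (Real.sqrt (2 * L)) δ ε (by positivity) hδ hδ1 hε hε1
    (Real.sq_sqrt (by positivity)) _ hq
  have hmT : Measurable (fun g : Fin p → Fin p → ℝ => mirror p (upperCov p n D' + g)) :=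
    (measurable_mirror p).comp (measurable_const_add _)
  have hmD : Measurable (fun g : Fin p → Fin p → ℝ => mirror p (upperCov p n D + g)) :=
    (measurable_mirror p).comp (measurable_const_add _)
  have hT := hmT hS
  have hdp := hCM.dp ε _ hT
  rw [law_eq, law_eq, Measure.map_apply hmD hS, Measure.map_apply hmT hS]
  rw [Measure.map_apply hCM.measShift hT] at hdp
  have hset : (fun g => b + g) ⁻¹' ((fun g => mirror p (upperCov p n D' + g)) ⁻¹' S)
      = (fun g => mirror p (upperCov p n D + g)) ⁻¹' S := by
    ext g
    simp only [Set.mem_preimage, hb]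
    rw [← add_assoc, add_sub_cancel]
  rw [hset] at hdp
  exact hdp.trans (add_le_add le_rfl htail)

/-- privacy of DP-Thresholding: with `σ₁ = 2·√(ln(1.25/δ))/(n·ε)`, for any two
datasets of unit-norm vectors differing in exactly one entry, the laws of `Σ* + N` (with `N` a
symmetric Gaussian noise matrix with parameter `σ₁`) satisfy the `(ε, δ)`-DP inequality, and so
do their images under any measurable post-processing map `f` (in particular the output of the
DP-Thresholding algorithm). -/
theorem dp_thresholding_privacy (p n : ℕ) (hn : 1 ≤ n)
    (ε δ : ℝ) (hε : 0 < ε) (hε1 : ε ≤ 1) (hδ : 0 < δ) (hδ1 : δ ≤ 1)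
    (σ₁ : ℝ) (hσ₁ : σ₁ = 2 * Real.sqrt (Real.log (1.25 / δ)) / (n * ε))
    (D D' : Fin n → Fin p → ℝ)
    (hD : ∀ k, ∑ i, D k i ^ 2 ≤ 1) (hD' : ∀ k, ∑ i, D' k i ^ 2 ≤ 1)
    (k₀ : Fin n) (hdiff : ∀ k, k ≠ k₀ → D k = D' k) (hne : D k₀ ≠ D' k₀) :
    (∀ S : Set (Matrix (Fin p) (Fin p) ℝ), MeasurableSet S →
      ((symmGaussian p (Real.toNNReal (σ₁ ^ 2))).map (fun N => empCov p n D + N)) S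
        ≤ ENNReal.ofReal (Real.exp ε) *
            ((symmGaussian p (Real.toNNReal (σ₁ ^ 2))).map (fun N => empCov p n D' + N)) S
          + ENNReal.ofReal δ) ∧
    ∀ (T : Type) (_ : MeasurableSpace T)
      (f : Matrix (Fin p) (Fin p) ℝ → T), Measurable f →
      ∀ S : Set T, MeasurableSet S →
        (((symmGaussian p (Real.toNNReal (σ₁ ^ 2))).map
            (fun N => empCov p n D + N)).map f) S
          ≤ ENNReal.ofReal (Real.exp ε) *
              (((symmGaussian p (Real.toNNReal (σ₁ ^ 2))).map
                (fun N => empCov p n D' + N)).map f) S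
            + ENNReal.ofReal δ := by
  have key := dp_main p n hn ε δ hε hε1 hδ hδ1 σ₁ hσ₁ D D' hD hD' k₀ hdiff
  refine ⟨key, fun T _ f hf S hS => ?_⟩
  rw [Measure.map_apply hf hS, Measure.map_apply hf hS]
  exact key _ (hf hS)
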